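/- There exist absolute constants C, c > 0 such that the following holds. Let p be a prime and A ⊆ F_p a nonempty finite set with |A²−A²|·|A−A|·|A| ≤ c·p². Then for every real s > 0, #{w ∈ A²−A² : |P_w| ≥ s} ≤ C·K⁴·M³·|A|²/s², where M := |A−A|/|A| and K := |A²−A²|/|A|. (Equivalently, listing A²−A² = {w₁, …, w_{|A²−A²|}} with |P_{w₁}| ≥ |P_{w₂}| ≥ …, one has |P_{w_n}| ≤ C·M^{3/2}·K²·|A|·n^{−1/2} for all n.) -/

import Mathlib

open Finset Pointwise

namespace FpSumProd

/-- `A² = {a² : a ∈ A}`. -/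
def sqSet {p : ℕ} (A : Finset (ZMod p)) : Finset (ZMod p) := A.image fun a => a ^ 2

/-- `A² - A² = {a² - b² : a, b ∈ A}` (here `A - B` denotes the pointwise difference set). -/
def sqDiff {p : ℕ} (A : Finset (ZMod p)) : Finset (ZMod p) := sqSet A - sqSet A

/-- `r_{A²-A²}(x)`: the number of pairs `(y, z) ∈ A² × A²` with `y - z = x`. -/
def rep {p : ℕ} (A : Finset (ZMod p)) (x : ZMod p) : ℕ :=
  ((sqSet A ×ˢ sqSet A).filter fun q => q.1 - q.2 = x).card

/-- `P = {x ∈ A²-A² : r_{A²-A²}(x) ≥ |A|²/(2·|A²-A²|)}`, i.e. `r_{A²-A²}(x) ≥ |A|/(2K)`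
with `K = |A²-A²|/|A|`. -/
noncomputable def popular {p : ℕ} (A : Finset (ZMod p)) : Finset (ZMod p) :=
  (sqDiff A).filter fun x =>
    (A.card : ℝ) ^ 2 / (2 * ((sqDiff A).card : ℝ)) ≤ (rep A x : ℝ)

/-- `P_w = (A²-A²) ∩ (P - w)` where `P - w = {x - w : x ∈ P}`. -/
noncomputable def Pw {p : ℕ} (A : Finset (ZMod p)) (w : ZMod p) : Finset (ZMod p) :=
  sqDiff A ∩ ((popular A).image fun x => x - w)

/-- `T_w = #{(u, v) ∈ P_w × P_w : u - v ∈ P}`. -/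
noncomputable def Tw {p : ℕ} (A : Finset (ZMod p)) (w : ZMod p) : ℕ :=
  ((Pw A w ×ˢ Pw A w).filter fun q => q.1 - q.2 ∈ popular A).card

/-- `X = Σ_{w ∈ A²-A²} #{(u, v) ∈ P_w × P_w : u - v ∈ P}`. -/
noncomputable def Xsum {p : ℕ} (A : Finset (ZMod p)) : ℕ :=
  ∑ w ∈ sqDiff A, Tw A w

/-- `E₄(A²)`: the number of `8`-tuples `(x₁,x₂,x₃,x₄,y₁,y₂,y₃,y₄) ∈ (A²)⁸` with
`x₁ - y₁ = x₂ - y₂ = x₃ - y₃ = x₄ - y₄`. -/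
noncomputable def E4 {p : ℕ} (A : Finset (ZMod p)) : ℕ :=
  Set.ncard {v : Fin 4 → ZMod p × ZMod p |
    (∀ i, (v i).1 ∈ sqSet A ∧ (v i).2 ∈ sqSet A) ∧
    ∀ i, (v i).1 - (v i).2 = (v 0).1 - (v 0).2}

section Lines

open MvPolynomial (pderiv)

variable {K : Type*} [Field K]

/-- The point with first coordinate `s` on the line `(t, c, e)`, i.e. on the line of direction
`(1, t, t²)` through `(0, c, e + t * c)`. -/
def linePoint (l : K × K × K) (s : K) : Fin 3 → K :=
  ![s, l.1 * s + l.2.1, l.1 ^ 2 * s + (l.2.2 + l.1 * l.2.1)]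

/-- The restriction of a polynomial in three variables to the line `(t, c, e)`. -/
noncomputable def lineRestr (l : K × K × K) : MvPolynomial (Fin 3) K →ₐ[K] Polynomial K :=
  MvPolynomial.aeval ![Polynomial.X, Polynomial.C l.1 * Polynomial.X + Polynomial.C l.2.1,
    Polynomial.C (l.1 ^ 2) * Polynomial.X + Polynomial.C (l.2.2 + l.1 * l.2.1)]

/-- The alternating form on (projective points dual to) lines whose vanishing expresses that two
lines meet, possibly at infinity. -/
def lineForm (l m : K × K × K) : K := l.2.2 - m.2.2 + l.1 * m.2.1 - m.1 * l.2.1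

lemma eval_lineRestr (l : K × K × K) (F : MvPolynomial (Fin 3) K) (s : K) :
    (lineRestr l F).eval s = MvPolynomial.eval (linePoint l s) F := by
  have h : (Polynomial.aeval s).comp (lineRestr l) = MvPolynomial.aeval (linePoint l s) := by
    ext i
    fin_cases i <;> simp [lineRestr, linePoint]
  simpa [MvPolynomial.aeval_eq_eval] using DFunLike.congr_fun h F

lemma natDegree_lineRestr_le (l : K × K × K) {F : MvPolynomial (Fin 3) K} {k : ℕ}
    (hF : F.totalDegree ≤ k) : (lineRestr l F).natDegree ≤ k := by
  have := MvPolynomial.aeval_natDegree_le (n := 1) F hF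
    ![Polynomial.X, Polynomial.C l.1 * Polynomial.X + Polynomial.C l.2.1,
      Polynomial.C (l.1 ^ 2) * Polynomial.X + Polynomial.C (l.2.2 + l.1 * l.2.1)] (by
      intro i
      fin_cases i
      · exact Polynomial.natDegree_X_le
      · exact Polynomial.natDegree_linear_le
      · exact Polynomial.natDegree_linear_le)
  simpa [lineRestr] using this

lemma derivative_lineRestr (l : K × K × K) (F : MvPolynomial (Fin 3) K) :
    Polynomial.derivative (lineRestr l F) =
      lineRestr l (pderiv 0 F) + Polynomial.C l.1 * lineRestr l (pderiv 1 F)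
        + Polynomial.C (l.1 ^ 2) * lineRestr l (pderiv 2 F) := by
  induction F using MvPolynomial.induction_on with
  | C a => simp [lineRestr]
  | add p q hp hq =>
    simp only [map_add, hp, hq]
    ring
  | mul_X p i hp =>
    simp only [map_mul, Polynomial.derivative_mul, hp, MvPolynomial.pderiv_mul, map_add]
    fin_cases i <;>
      simp [lineRestr, MvPolynomial.pderiv_X, Polynomial.derivative_pow] <;> ring

lemma pderiv_comm (i j : Fin 3) (F : MvPolynomial (Fin 3) K) :
    pderiv i (pderiv j F) =
      pderiv j (pderiv i F) := by
  ext m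
  simp only [MvPolynomial.coeff_pderiv, add_right_comm m]
  by_cases h : i = j
  · subst h; rfl
  · simp [h, Ne.symm h]
    ring

lemma totalDegree_pderiv_le (i : Fin 3) (F : MvPolynomial (Fin 3) K) :
    (pderiv i F).totalDegree ≤ F.totalDegree - 1 := by
  refine Finset.sup_le fun m hm => ?_
  have hm' : m + Finsupp.single i 1 ∈ F.support := by
    rw [MvPolynomial.mem_support_iff, MvPolynomial.coeff_pderiv] at hm
    exact MvPolynomial.mem_support_iff.2 (left_ne_zero_of_mul hm)
  have h := MvPolynomial.le_totalDegree hm'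
  rw [Finsupp.sum_add_index' (by simp) (by simp), Finsupp.sum_single_index rfl] at h
  exact Nat.le_sub_one_of_lt h

lemma eq_C_of_pderiv_eq_zero (p : ℕ) [CharP K p] {F : MvPolynomial (Fin 3) K}
    (hdeg : F.totalDegree < p) (h : ∀ i, pderiv i F = 0) :
    F = MvPolynomial.C (MvPolynomial.coeff 0 F) := by
  ext m
  rw [MvPolynomial.coeff_C]
  split_ifs with h0
  · rw [h0]
  by_contra hm
  obtain ⟨i, hi⟩ : ∃ i, m i ≠ 0 := by
    by_contra! hall
    exact h0 (Finsupp.ext fun i => (hall i).symm)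
  have hsub : m - Finsupp.single i 1 + Finsupp.single i 1 = m :=
    tsub_add_cancel_of_le (by simpa [Nat.one_le_iff_ne_zero] using hi)
  have hc := congrArg (MvPolynomial.coeff (m - Finsupp.single i 1)) (h i)
  rw [MvPolynomial.coeff_pderiv, hsub, MvPolynomial.coeff_zero] at hc
  have hcast : ((m - Finsupp.single i 1 : Fin 3 →₀ ℕ) i : K) + 1 = (m i : K) := by
    have : (m - Finsupp.single i 1 : Fin 3 →₀ ℕ) i + 1 = m i := by
      conv_rhs => rw [← hsub]
      simp
    exact_mod_cast congrArg (Nat.cast (R := K)) this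
  rw [hcast] at hc
  have hz : (m i : K) = 0 := (mul_eq_zero.1 hc).resolve_left hm
  have hdvd := (CharP.cast_eq_zero_iff K p (m i)).1 hz
  have hle : m i ≤ F.totalDegree := by
    refine le_trans ?_ (MvPolynomial.le_totalDegree (MvPolynomial.mem_support_iff.2 hm))
    exact Finset.single_le_sum (f := fun j => m j) (fun _ _ => Nat.zero_le _)
      (Finsupp.mem_support_iff.2 hi)
  exact absurd (Nat.le_of_dvd (Nat.pos_of_ne_zero hi) hdvd) (by omega)

/-- The polynomial along the line `l` whose vanishing means that the second isotropic direction of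
the tangent plane of `F = 0` is asymptotic. -/
noncomputable def asymptoticPoly (F : MvPolynomial (Fin 3) K) (l : K × K × K) : Polynomial K :=
  let f := fun i => lineRestr l (pderiv i F)
  let h := fun i j => lineRestr l (pderiv i (pderiv j F))
  let w := -(f 1 + Polynomial.C l.1 * f 2)
  h 0 0 * f 2 ^ 4 + 2 * h 0 1 * f 2 ^ 3 * w + (h 1 1 + 2 * h 0 2) * f 2 ^ 2 * w ^ 2
    + 2 * h 1 2 * f 2 * w ^ 3 + h 2 2 * w ^ 4

/-- With `tangentNum` and `lineRestr l (∂₂F)` as coefficients, the tangent planes of `F = 0` along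
the line `l` are determined. -/
noncomputable def tangentNum (F : MvPolynomial (Fin 3) K) (l : K × K × K) : Polynomial K :=
  lineRestr l (pderiv 1 F) + Polynomial.C (2 * l.1) * lineRestr l (pderiv 2 F)

/-- The numerator of the second derivative of `b / a`. -/
noncomputable def secondDerivNum (a b : Polynomial K) : Polynomial K :=
  a ^ 2 * Polynomial.derivative (Polynomial.derivative b)
    - a * b * Polynomial.derivative (Polynomial.derivative a)
    + 2 * Polynomial.derivative a * (Polynomial.derivative a * b - a * Polynomial.derivative b)

lemma tangent_eq_at_crossing {F : MvPolynomial (Fin 3) K} {u v : K × K × K} {s : K}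
    (hp : linePoint u s = linePoint v s) (ht : u.1 ≠ v.1) (hu : lineRestr u F = 0)
    (hv : lineRestr v F = 0) :
    (tangentNum F u).eval s + (v.1 - u.1) * (lineRestr u (pderiv 2 F)).eval s = 0 := by
  have h1 := congrArg (fun P => (Polynomial.derivative P).eval s) hu
  have h2 := congrArg (fun P => (Polynomial.derivative P).eval s) hv
  simp only [derivative_lineRestr, Polynomial.eval_add, Polynomial.eval_mul, Polynomial.eval_C,
    eval_lineRestr, Polynomial.derivative_zero, Polynomial.eval_zero, ← hp] at h1 h2
  simp only [tangentNum, Polynomial.eval_add, Polynomial.eval_mul, Polynomial.eval_C,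
    eval_lineRestr]
  have hne : v.1 - u.1 ≠ 0 := sub_ne_zero.2 ht.symm
  refine mul_left_cancel₀ hne ?_
  linear_combination h2 - h1

lemma asymptoticPoly_eval_eq_zero {F : MvPolynomial (Fin 3) K} {u v : K × K × K} {s : K}
    (hp : linePoint u s = linePoint v s) (ht : u.1 ≠ v.1) (hu : lineRestr u F = 0)
    (hv : lineRestr v F = 0) : (asymptoticPoly F v).eval s = 0 := by
  have h1 := congrArg (fun P => (Polynomial.derivative P).eval s) hu
  have h2 := congrArg (fun P => (Polynomial.derivative P).eval s) hv
  have h3 := congrArg (fun P => (Polynomial.derivative (Polynomial.derivative P)).eval s) hu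
  simp only [derivative_lineRestr, Polynomial.eval_add, Polynomial.eval_mul, Polynomial.eval_C,
    eval_lineRestr, Polynomial.derivative_zero, Polynomial.eval_zero, Polynomial.derivative_add,
    Polynomial.derivative_C_mul, ← hp, pderiv_comm 1 0, pderiv_comm 2 0, pderiv_comm 2 1]
    at h1 h2 h3
  simp only [asymptoticPoly, Polynomial.eval_add, Polynomial.eval_mul, Polynomial.eval_C,
    eval_lineRestr, Polynomial.eval_pow, Polynomial.eval_neg, Polynomial.eval_ofNat, ← hp]
  have hne : v.1 - u.1 ≠ 0 := sub_ne_zero.2 ht.symm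
  generalize MvPolynomial.eval (linePoint u s) (pderiv 2 F) = f2 at *
  generalize MvPolynomial.eval (linePoint u s) (pderiv 1 F) = f1 at *
  have hw : -(f1 + v.1 * f2) = u.1 * f2 := by
    refine mul_left_cancel₀ hne ?_
    linear_combination h1 - h2
  rw [hw]
  linear_combination f2 ^ 4 * h3

lemma secondDerivNum_eval_eq_zero {F : MvPolynomial (Fin 3) K} {u v : K × K × K} {s : K}
    (hp : linePoint u s = linePoint v s) (ht : u.1 ≠ v.1) (hu : lineRestr u F = 0)
    (hv : lineRestr v F = 0) (hvF : asymptoticPoly F v = 0) :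
    (secondDerivNum (tangentNum F u) (lineRestr u (pderiv 2 F))).eval s = 0 := by
  have h1 := congrArg (fun P => (Polynomial.derivative P).eval s) hu
  have h2 := congrArg (fun P => (Polynomial.derivative P).eval s) hv
  have h3 := congrArg (fun P => (Polynomial.derivative (Polynomial.derivative P)).eval s) hu
  have h4 := congrArg (fun P => (Polynomial.derivative (Polynomial.derivative P)).eval s) hv
  have h5 := congrArg (fun P =>
    (Polynomial.derivative (Polynomial.derivative (Polynomial.derivative P))).eval s) hu
  have h6 := congrArg (fun P => (Polynomial.derivative P).eval s) hvF
  simp only [asymptoticPoly, derivative_lineRestr, Polynomial.eval_add, Polynomial.eval_mul,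
    Polynomial.eval_C, Polynomial.derivative_mul, Polynomial.derivative_pow,
    Polynomial.derivative_neg, Polynomial.eval_pow, Polynomial.eval_neg,
    Polynomial.derivative_ofNat, Polynomial.eval_ofNat, Polynomial.derivative_C, Nat.cast_ofNat,
    eval_lineRestr, Polynomial.derivative_zero, Polynomial.eval_zero, Polynomial.derivative_add,
    ← hp, pderiv_comm 1 0, pderiv_comm 2 0, pderiv_comm 2 1] at h1 h2 h3 h4 h5 h6
  simp only [secondDerivNum, tangentNum, derivative_lineRestr, Polynomial.eval_add,
    Polynomial.eval_mul, Polynomial.eval_sub, Polynomial.eval_ofNat,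
    Polynomial.eval_C, Polynomial.derivative_mul, Polynomial.eval_pow, Polynomial.derivative_C,
    eval_lineRestr, Polynomial.derivative_zero, Polynomial.eval_zero, Polynomial.derivative_add,
    pderiv_comm 1 0, pderiv_comm 2 0, pderiv_comm 2 1]
  have hne : v.1 - u.1 ≠ 0 := sub_ne_zero.2 ht.symm
  generalize MvPolynomial.eval (linePoint u s) (pderiv 0 (pderiv 0 (pderiv 0 F))) = f000 at *
  generalize MvPolynomial.eval (linePoint u s) (pderiv 0 (pderiv 0 (pderiv 1 F))) = f001 at *
  generalize MvPolynomial.eval (linePoint u s) (pderiv 0 (pderiv 0 (pderiv 2 F))) = f002 at *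
  generalize MvPolynomial.eval (linePoint u s) (pderiv 0 (pderiv 1 (pderiv 1 F))) = f011 at *
  generalize MvPolynomial.eval (linePoint u s) (pderiv 0 (pderiv 1 (pderiv 2 F))) = f012 at *
  generalize MvPolynomial.eval (linePoint u s) (pderiv 0 (pderiv 2 (pderiv 2 F))) = f022 at *
  generalize MvPolynomial.eval (linePoint u s) (pderiv 1 (pderiv 1 (pderiv 1 F))) = f111 at *
  generalize MvPolynomial.eval (linePoint u s) (pderiv 1 (pderiv 1 (pderiv 2 F))) = f112 at *
  generalize MvPolynomial.eval (linePoint u s) (pderiv 1 (pderiv 2 (pderiv 2 F))) = f122 at *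
  generalize MvPolynomial.eval (linePoint u s) (pderiv 2 (pderiv 2 (pderiv 2 F))) = f222 at *
  generalize MvPolynomial.eval (linePoint u s) (pderiv 0 (pderiv 0 F)) = f00 at *
  generalize MvPolynomial.eval (linePoint u s) (pderiv 0 (pderiv 1 F)) = f01 at *
  generalize MvPolynomial.eval (linePoint u s) (pderiv 0 (pderiv 2 F)) = f02 at *
  generalize MvPolynomial.eval (linePoint u s) (pderiv 1 (pderiv 1 F)) = f11 at *
  generalize MvPolynomial.eval (linePoint u s) (pderiv 1 (pderiv 2 F)) = f12 at *
  generalize MvPolynomial.eval (linePoint u s) (pderiv 2 (pderiv 2 F)) = f22 at *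
  generalize MvPolynomial.eval (linePoint u s) (pderiv 0 F) = f0 at *
  generalize MvPolynomial.eval (linePoint u s) (pderiv 1 F) = f1 at *
  generalize MvPolynomial.eval (linePoint u s) (pderiv 2 F) = f2 at *
  generalize u.1 = t at *
  generalize v.1 = r at *
  have hf1 : f1 = -(t + r) * f2 := by
    refine mul_left_cancel₀ hne ?_
    linear_combination h2 - h1
  subst hf1
  have hwt : -((f01 + r * f11 + r ^ 2 * f12) + (t + r) * (f02 + r * f12 + r ^ 2 * f22)) =
      f01 + t * f11 + t ^ 2 * f12 + (r + t) * (f02 + t * f12 + t ^ 2 * f22) := by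
    refine mul_left_cancel₀ hne ?_
    linear_combination h3 - h4
  by_cases hb : f2 = 0
  · subst hb
    ring
  have hK : f2 * ((f000 + t * f001 + t ^ 2 * f002)
        + t * (f001 + t * f011 + t ^ 2 * f012) + t ^ 2 * (f002 + t * f012 + t ^ 2 * f022)
        + r * ((f001 + t * f011 + t ^ 2 * f012)
        + t * (f011 + t * f111 + t ^ 2 * f112) + t ^ 2 * (f012 + t * f112 + t ^ 2 * f122))
        + r ^ 2 * ((f002 + t * f012 + t ^ 2 * f022)
        + t * (f012 + t * f112 + t ^ 2 * f122) + t ^ 2 * (f022 + t * f122 + t ^ 2 * f222)))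
      - 2 * (f01 + t * f11 + t ^ 2 * f12 + 2 * t * (f02 + t * f12 + t ^ 2 * f22)) *
      ((f01 + r * f11 + r ^ 2 * f12) + (t + r) * (f02 + r * f12 + r ^ 2 * f22)) = 0 := by
    refine mul_left_cancel₀ (pow_ne_zero 3 hb) ?_
    linear_combination h6 - 4 * f2 ^ 3 * (f02 + r * f12 + r ^ 2 * f22) * h3
  linear_combination f2 * hK - f2 ^ 2 * h5 - 2 * f2 *
    (f01 + t * f11 + t ^ 2 * f12 + 2 * t * (f02 + t * f12 + t ^ 2 * f22)) * hwt

lemma exists_eq_C_mul_of_wronskian (p : ℕ) [CharP K p] {u w : Polynomial K} (hw : w ≠ 0)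
    (hup : u.natDegree < p) (hwp : w.natDegree < p)
    (h : Polynomial.derivative u * w = u * Polynomial.derivative w) :
    ∃ α, u = Polynomial.C α * w := by
  refine ⟨u.coeff w.natDegree / w.leadingCoeff, ?_⟩
  set α := u.coeff w.natDegree / w.leadingCoeff
  have hlc : w.leadingCoeff ≠ 0 := Polynomial.leadingCoeff_ne_zero.2 hw
  by_contra hne
  set x := u - Polynomial.C α * w with hx
  have hx0 : x ≠ 0 := sub_ne_zero.2 hne
  have hxn : x.coeff w.natDegree = 0 := by
    simp [hx, α, Polynomial.coeff_natDegree, hlc]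
  have hxp : x.natDegree < p := by
    refine lt_of_le_of_lt (Polynomial.natDegree_sub_le _ _) (max_lt hup ?_)
    exact lt_of_le_of_lt (Polynomial.natDegree_C_mul_le _ _) hwp
  have key : Polynomial.X * Polynomial.derivative x * w
      = x * (Polynomial.X * Polynomial.derivative w) := by
    simp only [hx, Polynomial.derivative_sub, Polynomial.derivative_C_mul]
    linear_combination Polynomial.X * h
  have hd : ∀ q : Polynomial K,
      (Polynomial.X * Polynomial.derivative q).natDegree ≤ q.natDegree := by
    intro q
    rcases Nat.eq_zero_or_pos q.natDegree with h0 | h0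
    · rw [Polynomial.derivative_of_natDegree_zero h0]
      simp
    · have h1 := Polynomial.natDegree_derivative_lt h0.ne'
      have h2 := Polynomial.natDegree_mul_le (p := Polynomial.X) (q := Polynomial.derivative q)
      rw [Polynomial.natDegree_X] at h2
      omega
  have hc : ∀ (q : Polynomial K) (n : ℕ),
      (Polynomial.X * Polynomial.derivative q).coeff n = n * q.coeff n := by
    intro q n
    cases n with
    | zero => simp
    | succ n =>
      rw [Polynomial.coeff_X_mul, Polynomial.coeff_derivative]
      push_cast
      ring
  have hco := congrArg (fun q => q.coeff (x.natDegree + w.natDegree)) key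
  rw [Polynomial.coeff_mul_add_eq_of_natDegree_le (hd x) le_rfl,
    Polynomial.coeff_mul_add_eq_of_natDegree_le le_rfl (hd w), hc, hc, Polynomial.coeff_natDegree,
    Polynomial.coeff_natDegree] at hco
  have hxlc : x.leadingCoeff ≠ 0 := Polynomial.leadingCoeff_ne_zero.2 hx0
  have hcast : (x.natDegree : K) = (w.natDegree : K) := by
    refine mul_right_cancel₀ (mul_ne_zero hxlc hlc) ?_
    linear_combination hco
  have := CharP.natCast_injOn_Iio K p hxp hwp hcast
  rw [← this, Polynomial.coeff_natDegree] at hxn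
  exact hxlc hxn

lemma exists_eq_linear_mul_of_secondDerivNum_eq_zero (p : ℕ) [CharP K p] {a b : Polynomial K}
    {k : ℕ} (ha : a ≠ 0) (hak : a.natDegree ≤ k) (hbk : b.natDegree ≤ k) (hkp : 2 * k + 1 < p)
    (h : secondDerivNum a b = 0) :
    ∃ α β, b = (Polynomial.C α * Polynomial.X + Polynomial.C β) * a := by
  have hder : ∀ q : Polynomial K, q.natDegree ≤ k → (Polynomial.derivative q).natDegree ≤ k :=
    fun q hq => (Polynomial.natDegree_derivative_le q).trans (by omega)
  have hmul : ∀ q r : Polynomial K, q.natDegree ≤ k → r.natDegree ≤ k →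
      (q * r).natDegree ≤ 2 * k := fun q r hq hr => Polynomial.natDegree_mul_le.trans (by omega)
  obtain ⟨α, hα⟩ := exists_eq_C_mul_of_wronskian p
    (u := Polynomial.derivative b * a - b * Polynomial.derivative a) (w := a ^ 2)
    (pow_ne_zero 2 ha)
    (lt_of_le_of_lt (Polynomial.natDegree_sub_le_of_le (hmul _ _ (hder b hbk) hak)
      (hmul _ _ hbk (hder a hak))) (by simp; omega))
    (by rw [sq]; exact lt_of_le_of_lt (hmul _ _ hak hak) (by omega)) (by
      simp only [Polynomial.derivative_sub, Polynomial.derivative_mul, sq]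
      unfold secondDerivNum at h
      linear_combination a * h)
  obtain ⟨β, hβ⟩ := exists_eq_C_mul_of_wronskian p
    (u := b - Polynomial.C α * Polynomial.X * a) (w := a) ha (by
      refine lt_of_le_of_lt (Polynomial.natDegree_sub_le _ _) (max_lt (by omega) ?_)
      refine lt_of_le_of_lt Polynomial.natDegree_mul_le ?_
      have := Polynomial.natDegree_C_mul_le α (Polynomial.X : Polynomial K)
      rw [Polynomial.natDegree_X] at this
      omega) (by omega) (by
      simp only [Polynomial.derivative_sub, Polynomial.derivative_mul, Polynomial.derivative_C,
        Polynomial.derivative_X]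
      linear_combination hα)
  exact ⟨α, β, by linear_combination hβ⟩

lemma natDegree_asymptoticPoly_le {F : MvPolynomial (Fin 3) K} {k : ℕ} (hF : F.totalDegree ≤ k)
    (l : K × K × K) : (asymptoticPoly F l).natDegree ≤ 5 * k := by
  have h1 : ∀ i, (lineRestr l (pderiv i F)).natDegree ≤ k := fun i =>
    natDegree_lineRestr_le l ((totalDegree_pderiv_le i F).trans (by omega))
  have h2 : ∀ i j, (lineRestr l (pderiv i (pderiv j F))).natDegree ≤ k :=
    fun i j => natDegree_lineRestr_le l ((totalDegree_pderiv_le i _).trans (by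
      have := totalDegree_pderiv_le j F
      omega))
  have hw : (-(lineRestr l (pderiv 1 F) + Polynomial.C l.1 *
      lineRestr l (pderiv 2 F))).natDegree ≤ k := by
    rw [Polynomial.natDegree_neg]
    exact Polynomial.natDegree_add_le_of_degree_le (h1 1)
      ((Polynomial.natDegree_C_mul_le _ _).trans (h1 2))
  have hc : ∀ {q : Polynomial K} {n : ℕ}, q.natDegree ≤ n → (2 * q).natDegree ≤ n := fun hq =>
    (Polynomial.natDegree_C_mul_le (2 : K) _).trans hq
  have hm : ∀ {q r : Polynomial K} {m n : ℕ}, q.natDegree ≤ m → r.natDegree ≤ n →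
    (q * r).natDegree ≤ m + n := fun hq hr => Polynomial.natDegree_mul_le_of_le hq hr
  have hpow : ∀ {q : Polynomial K} (n : ℕ), q.natDegree ≤ k → (q ^ n).natDegree ≤ n * k :=
    fun n hq => Polynomial.natDegree_pow_le_of_le n hq
  have hb := h1 2
  refine Polynomial.natDegree_add_le_of_degree_le (Polynomial.natDegree_add_le_of_degree_le
    (Polynomial.natDegree_add_le_of_degree_le (Polynomial.natDegree_add_le_of_degree_le
      ((hm (h2 0 0) (hpow 4 hb)).trans ?_) ((hm (hm (hc (h2 0 1)) (hpow 3 hb)) hw).trans ?_))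
    ((hm (hm (Polynomial.natDegree_add_le_of_degree_le (h2 1 1) (hc (h2 0 2)))
      (hpow 2 hb)) (hpow 2 hw)).trans ?_))
    ((hm (hm (hc (h2 1 2)) hb) (hpow 3 hw)).trans ?_)) ((hm (h2 2 2) (hpow 4 hw)).trans ?_)
  all_goals omega

lemma natDegree_tangentNum_le {F : MvPolynomial (Fin 3) K} {k : ℕ} (hF : F.totalDegree ≤ k)
    (l : K × K × K) : (tangentNum F l).natDegree ≤ k := by
  have h1 : ∀ i, (lineRestr l (pderiv i F)).natDegree ≤ k := fun i =>
    natDegree_lineRestr_le l ((totalDegree_pderiv_le i F).trans (by omega))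
  exact Polynomial.natDegree_add_le_of_degree_le (h1 1)
    ((Polynomial.natDegree_C_mul_le _ _).trans (h1 2))

lemma natDegree_secondDerivNum_le {a b : Polynomial K} {k : ℕ} (ha : a.natDegree ≤ k)
    (hb : b.natDegree ≤ k) : (secondDerivNum a b).natDegree ≤ 3 * k := by
  have hder : ∀ {q : Polynomial K}, q.natDegree ≤ k → (Polynomial.derivative q).natDegree ≤ k :=
    fun hq => (Polynomial.natDegree_derivative_le _).trans (by omega)
  have hc : ∀ {q : Polynomial K} {n : ℕ}, q.natDegree ≤ n → (2 * q).natDegree ≤ n := fun hq =>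
    (Polynomial.natDegree_C_mul_le (2 : K) _).trans hq
  have hm : ∀ {q r : Polynomial K} {m n : ℕ}, q.natDegree ≤ m → r.natDegree ≤ n →
    (q * r).natDegree ≤ m + n := fun hq hr => Polynomial.natDegree_mul_le_of_le hq hr
  have hs : ∀ {q r : Polynomial K} {n : ℕ}, q.natDegree ≤ n → r.natDegree ≤ n →
    (q - r).natDegree ≤ n := fun hq hr => (Polynomial.natDegree_sub_le_of_le hq hr).trans (by simp)
  refine Polynomial.natDegree_add_le_of_degree_le (hs
    ((hm (Polynomial.natDegree_pow_le_of_le 2 ha) (hder (hder hb))).trans ?_)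
    ((hm (hm ha hb) (hder (hder ha))).trans ?_)) ((hm (hc (hder ha))
    (hs (hm (hder ha) hb) (hm ha (hder hb)))).trans ?_)
  all_goals omega

lemma sum_card_filter_le_of_degenerate {α β : Type*} [DecidableEq α] [DecidableEq β]
    (r : α → β → Prop) [DecidableRel r] (D : ℕ) (U : Finset α) (V : Finset β)
    (h : ∀ U' ⊆ U, ∀ V' ⊆ V, U'.Nonempty → V'.Nonempty →
      (∃ u ∈ U', #{v ∈ V' | r u v} ≤ D) ∨ ∃ v ∈ V', #{u ∈ U' | r u v} ≤ D) :
    ∑ u ∈ U, #{v ∈ V | r u v} ≤ D * (#U + #V) := by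
  induction hn : #U + #V generalizing U V with
  | zero =>
    have : U = ∅ := card_eq_zero.1 (by omega)
    simp [this]
  | succ n ih =>
    rcases U.eq_empty_or_nonempty with rfl | hU
    · simp
    rcases V.eq_empty_or_nonempty with rfl | hV
    · simp
    rcases h U subset_rfl V subset_rfl hU hV with ⟨u, hu, hle⟩ | ⟨v, hv, hle⟩
    · have hcard := card_erase_add_one hu
      have := ih (U.erase u) V
        (fun U' hU' V' hV' => h U' (hU'.trans (erase_subset _ _)) V' hV') (by omega)
      rw [← add_sum_erase _ _ hu, mul_add]
      omega
    · have hcard := card_erase_add_one hv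
      have := ih U (V.erase v)
        (fun U' hU' V' hV' => h U' hU' V' (hV'.trans (erase_subset _ _))) (by omega)
      have hswap := sum_card_bipartiteAbove_eq_sum_card_bipartiteBelow r (s := U) (t := V)
      have hswap' := sum_card_bipartiteAbove_eq_sum_card_bipartiteBelow r (s := U) (t := V.erase v)
      simp only [bipartiteAbove, bipartiteBelow] at hswap hswap'
      rw [hswap'] at this
      rw [hswap, ← add_sum_erase _ _ hv, mul_add]
      omega

/-- The first coordinate of the intersection point of two lines of different slopes. -/
def crossParam (u v : K × K × K) : K := (u.2.1 - v.2.1) / (v.1 - u.1)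

/-- Homogeneous coordinates of the point dual to a line. -/
def lineVec (l : K × K × K) : Fin 4 → K := ![1, l.1, l.2.1, l.2.2]

lemma lineForm_swap (u v : K × K × K) : lineForm v u = -lineForm u v := by
  unfold lineForm
  ring

lemma crossParam_comm (u v : K × K × K) : crossParam u v = crossParam v u := by
  unfold crossParam
  rw [← neg_sub v.2.1, ← neg_sub u.1, neg_div_neg_eq]

lemma linePoint_crossParam {u v : K × K × K} (ht : u.1 ≠ v.1) (h : lineForm u v = 0) :
    linePoint u (crossParam u v) = linePoint v (crossParam u v) := by
  have hs : crossParam u v * (v.1 - u.1) = u.2.1 - v.2.1 :=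
    div_mul_cancel₀ _ (sub_ne_zero.2 ht.symm)
  unfold lineForm at h
  ext i
  fin_cases i
  · simp [linePoint]
  · simp only [linePoint, Fin.mk_one, Matrix.cons_val_one, Matrix.cons_val_zero]
    linear_combination -hs
  · simp only [linePoint, Fin.reduceFinMk, Matrix.cons_val]
    linear_combination h - (u.1 + v.1) * hs

lemma lineForm_eq_zero_of_linePoint_eq {u v : K × K × K} {s : K}
    (h : linePoint u s = linePoint v s) : lineForm u v = 0 := by
  have h1 := congrFun h 1
  have h2 := congrFun h 2
  simp only [linePoint, Matrix.cons_val_one, Matrix.cons_val_zero, Matrix.cons_val] at h1 h2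
  unfold lineForm
  linear_combination h2 - (u.1 + v.1) * h1

lemma card_le_natDegree_of_crossings {u : K × K × K} {S : Finset (K × K × K)}
    (hS : ∀ v ∈ S, u.1 ≠ v.1 ∧ lineForm u v = 0)
    (hpair : ∀ v ∈ S, ∀ w ∈ S, v ≠ w → lineForm v w ≠ 0) {P : Polynomial K} (hP : P ≠ 0)
    (hroot : ∀ v ∈ S, P.eval (crossParam u v) = 0) : #S ≤ P.natDegree := by
  classical
  by_contra! hlt
  have hinj : Set.InjOn (crossParam u) S := by
    intro v hv w hw hvw
    by_contra hne
    refine hpair v hv w hw hne (lineForm_eq_zero_of_linePoint_eq (s := crossParam u v) ?_)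
    rw [← linePoint_crossParam (hS v hv).1 (hS v hv).2, hvw,
      linePoint_crossParam (hS w hw).1 (hS w hw).2]
  refine hP (Polynomial.eq_zero_of_natDegree_lt_card_of_eval_eq_zero' P (S.image (crossParam u))
    ?_ ?_)
  · intro i hi
    obtain ⟨v, hv, rfl⟩ := mem_image.1 hi
    exact hroot v hv
  · rwa [card_image_of_injOn hinj]

/-- Two families of lines, pairwise skew within each family, such that at most `κ` of the lines of
the second family which meet a given line of the first are collinear in the dual picture. -/
structure IsLineConfig (U V : Finset (K × K × K)) (κ : ℕ) : Prop where
  skew_left : ∀ u ∈ U, ∀ u' ∈ U, u ≠ u' → lineForm u u' ≠ 0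
  skew_right : ∀ v ∈ V, ∀ v' ∈ V, v ≠ v' → lineForm v v' ≠ 0
  slope_ne : ∀ u ∈ U, ∀ v ∈ V, u.1 ≠ v.1
  collinear : ∀ u ∈ U, ∀ x y : Fin 4 → K, ∀ S ⊆ V,
    (∀ v ∈ S, lineForm u v = 0 ∧ lineVec v ∈ Submodule.span K {x, y}) → #S ≤ κ

lemma IsLineConfig.mono {U V U' V' : Finset (K × K × K)} {κ : ℕ} (h : IsLineConfig U V κ)
    (hU : U' ⊆ U) (hV : V' ⊆ V) : IsLineConfig U' V' κ where
  skew_left u hu u' hu' := h.skew_left u (hU hu) u' (hU hu')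
  skew_right v hv v' hv' := h.skew_right v (hV hv) v' (hV hv')
  slope_ne u hu v hv := h.slope_ne u (hU hu) v (hV hv)
  collinear u hu x y S hS := h.collinear u (hU hu) x y S (hS.trans hV)

lemma lineVec_mem_span {u v : K × K × K} (ht : u.1 ≠ v.1) (h : lineForm u v = 0) {α β : K}
    (hl : 1 + (v.1 - u.1) * (α * crossParam u v + β) = 0) :
    lineVec v ∈ Submodule.span K {![β, β * u.1 - 1, β * u.2.1, β * u.2.2 + u.2.1],
      ![α, α * u.1, α * u.2.1 + 1, α * u.2.2 + u.1]} := by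
  have hs : crossParam u v * (v.1 - u.1) = u.2.1 - v.2.1 :=
    div_mul_cancel₀ _ (sub_ne_zero.2 ht.symm)
  unfold lineForm at h
  set s := crossParam u v
  refine Submodule.mem_span_pair.2 ⟨-(v.1 - u.1), -(v.1 - u.1) * s, ?_⟩
  ext i
  fin_cases i
  · simp [lineVec]
    linear_combination -hl
  · simp [lineVec]
    linear_combination -u.1 * hl
  · simp [lineVec]
    linear_combination -u.2.1 * hl - hs
  · simp [lineVec]
    linear_combination -u.2.2 * hl - u.1 * hs + h

section Counting

variable [DecidableEq K]

lemma crossings_le_of_regular (p : ℕ) [CharP K p] {U V : Finset (K × K × K)} {κ k : ℕ}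
    (hUV : IsLineConfig U V κ) {F : MvPolynomial (Fin 3) K} (hF : F.totalDegree ≤ k)
    (hkp : 2 * k + 1 < p) (hU : ∀ u ∈ U, lineRestr u F = 0) (hV : ∀ v ∈ V, lineRestr v F = 0)
    (hreg : ∀ u ∈ U, ¬(lineRestr u (pderiv 1 F) = 0 ∧
      lineRestr u (pderiv 2 F) = 0)) :
    ∑ u ∈ U, #{v ∈ V | lineForm u v = 0} ≤ (5 * k + κ) * (#U + #V) := by
  classical
  refine sum_card_filter_le_of_degenerate (fun u v => lineForm u v = 0) _ U V ?_
  intro U' hU' V' hV' ⟨u, hu⟩ _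
  by_contra! hcon
  obtain ⟨hcu, hcv⟩ := hcon
  have hasym : ∀ v ∈ V', asymptoticPoly F v = 0 := by
    intro v hv
    by_contra hne
    have := card_le_natDegree_of_crossings (u := v) (S := {u ∈ U' | lineForm u v = 0})
      (fun w hw => by
        rw [mem_filter] at hw
        exact ⟨(hUV.slope_ne w (hU' hw.1) v (hV' hv)).symm, by rw [lineForm_swap, hw.2, neg_zero]⟩)
      (fun w hw w' hw' => hUV.skew_left w (hU' (mem_filter.1 hw).1) w' (hU' (mem_filter.1 hw').1))
      hne (fun w hw => by
        rw [mem_filter] at hw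
        have hne := hUV.slope_ne w (hU' hw.1) v (hV' hv)
        rw [crossParam_comm]
        exact asymptoticPoly_eval_eq_zero (linePoint_crossParam hne hw.2) hne (hU w (hU' hw.1))
          (hV v (hV' hv)))
    have h5 := natDegree_asymptoticPoly_le hF v
    have := hcv v hv
    omega
  set a := tangentNum F u with ha
  set b := lineRestr u (pderiv 2 F) with hb
  have hak : a.natDegree ≤ k := natDegree_tangentNum_le hF u
  have hbk : b.natDegree ≤ k :=
    natDegree_lineRestr_le u ((totalDegree_pderiv_le 2 F).trans (by omega))
  have hcross : ∀ S ⊆ {v ∈ V' | lineForm u v = 0}, ∀ P : Polynomial K, P ≠ 0 →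
      (∀ v ∈ S, P.eval (crossParam u v) = 0) → #S ≤ P.natDegree := by
    intro S hS P hP hroot
    refine card_le_natDegree_of_crossings (fun v hv => ?_) (fun v hv w hw => ?_) hP hroot
    · have hv' := mem_filter.1 (hS hv)
      exact ⟨hUV.slope_ne u (hU' hu) v (hV' hv'.1), hv'.2⟩
    · exact hUV.skew_right v (hV' (mem_filter.1 (hS hv)).1) w (hV' (mem_filter.1 (hS hw)).1)
  have htan : ∀ v ∈ V', lineForm u v = 0 →
      a.eval (crossParam u v) + (v.1 - u.1) * b.eval (crossParam u v) = 0 := by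
    intro v hv huv
    have hne := hUV.slope_ne u (hU' hu) v (hV' hv)
    exact tangent_eq_at_crossing (linePoint_crossParam hne huv) hne (hU u (hU' hu)) (hV v (hV' hv))
  have hdeg := hcu u hu
  have hsec : secondDerivNum a b = 0 := by
    by_contra hne
    have := hcross _ subset_rfl _ hne (fun v hv => by
      rw [mem_filter] at hv
      have hne := hUV.slope_ne u (hU' hu) v (hV' hv.1)
      exact secondDerivNum_eval_eq_zero (linePoint_crossParam hne hv.2) hne (hU u (hU' hu))
        (hV v (hV' hv.1)) (hasym v hv.1))
    have := natDegree_secondDerivNum_le hak hbk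
    omega
  by_cases ha0 : a = 0
  · have hb0 : b ≠ 0 := by
      intro hb0
      refine hreg u (hU' hu) ⟨?_, hb0⟩
      have : lineRestr u (pderiv 1 F) = a - Polynomial.C (2 * u.1) * b := by
        rw [ha, hb, tangentNum]
        ring
      rw [this, ha0, hb0]
      simp
    have := hcross _ subset_rfl b hb0 (fun v hv => by
      rw [mem_filter] at hv
      have h := htan v hv.1 hv.2
      rw [ha0, Polynomial.eval_zero, zero_add] at h
      exact (mul_eq_zero.1 h).resolve_left
        (sub_ne_zero.2 (hUV.slope_ne u (hU' hu) v (hV' hv.1)).symm))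
    omega
  obtain ⟨α, β, hαβ⟩ := exists_eq_linear_mul_of_secondDerivNum_eq_zero p ha0 hak hbk hkp hsec
  set N : Finset (K × K × K) := {v ∈ V' | lineForm u v = 0} with hN
  have h1 := hcross (N.filter fun v => a.eval (crossParam u v) = 0) (filter_subset _ _) a ha0
    (fun v hv => (mem_filter.1 hv).2)
  have h2 := hUV.collinear u (hU' hu) _ _ (N.filter fun v => ¬ a.eval (crossParam u v) = 0)
    (fun v hv => hV' (mem_filter.1 (mem_filter.1 hv).1).1) (fun v hv => by
      rw [mem_filter, hN, mem_filter] at hv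
      refine ⟨hv.1.2, lineVec_mem_span (α := α) (β := β)
        (hUV.slope_ne u (hU' hu) v (hV' hv.1.1)) hv.1.2 ?_⟩
      have h := htan v hv.1.1 hv.1.2
      rw [hαβ] at h
      simp only [Polynomial.eval_mul, Polynomial.eval_add, Polynomial.eval_C,
        Polynomial.eval_X] at h
      refine mul_left_cancel₀ hv.2 ?_
      linear_combination h)
  have h3 := card_filter_add_card_filter_not (s := N) fun v => a.eval (crossParam u v) = 0
  omega

lemma card_crossings_le_of_restr_ne_zero {u : K × K × K} {V : Finset (K × K × K)} {k : ℕ}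
    (hs : ∀ v ∈ V, u.1 ≠ v.1) (hV : ∀ v ∈ V, ∀ v' ∈ V, v ≠ v' → lineForm v v' ≠ 0)
    {F : MvPolynomial (Fin 3) K} (hF : F.totalDegree ≤ k) (hu : lineRestr u F ≠ 0)
    (hVF : ∀ v ∈ V, lineRestr v F = 0) : #{v ∈ V | lineForm u v = 0} ≤ k := by
  refine (card_le_natDegree_of_crossings (u := u) (fun v hv => ?_) (fun v hv w hw => ?_) hu
    fun v hv => ?_).trans (natDegree_lineRestr_le u hF)
  · rw [mem_filter] at hv
    exact ⟨hs v hv.1, hv.2⟩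
  · exact hV v (mem_filter.1 hv).1 w (mem_filter.1 hw).1
  · rw [mem_filter] at hv
    rw [eval_lineRestr, linePoint_crossParam (hs v hv.1) hv.2, ← eval_lineRestr,
      hVF v hv.1, Polynomial.eval_zero]

/-- Two families of lines contained in a surface of degree `k` have few incidences. -/
lemma crossings_le_of_surface (p : ℕ) [CharP K p] {κ k : ℕ} (hkp : 2 * k + 1 < p)
    {U V : Finset (K × K × K)} (hUV : IsLineConfig U V κ) {F : MvPolynomial (Fin 3) K}
    (hF0 : F ≠ 0) (hF : F.totalDegree ≤ k) (hU : ∀ u ∈ U, lineRestr u F = 0)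
    (hV : ∀ v ∈ V, lineRestr v F = 0) :
    ∑ u ∈ U, #{v ∈ V | lineForm u v = 0} ≤ (6 * k + κ) * (#U + #V) := by
  classical
  induction k generalizing U V F with
  | zero =>
    obtain rfl : U = ∅ := by
      refine eq_empty_of_forall_notMem fun u hu => hF0 ?_
      have h := hU u hu
      rw [MvPolynomial.totalDegree_eq_zero_iff_eq_C.1 (Nat.le_zero.1 hF)] at h ⊢
      simpa [lineRestr] using h
    simp
  | succ k ih =>
    rcases U.eq_empty_or_nonempty with rfl | ⟨u₀, hu₀⟩
    · simp
    obtain ⟨i, hi⟩ : ∃ i, pderiv i F ≠ 0 := by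
      by_contra! hall
      refine hF0 ?_
      have hC := eq_C_of_pderiv_eq_zero p (by omega) hall
      have h := hU u₀ hu₀
      rw [hC] at h ⊢
      simpa [lineRestr] using h
    have hdeg : ∀ j, (pderiv j F).totalDegree ≤ k := fun j =>
      (totalDegree_pderiv_le j F).trans (by omega)
    let sing : K × K × K → Prop := fun l => lineRestr l (pderiv 1 F) = 0 ∧
      lineRestr l (pderiv 2 F) = 0
    have hsing : ∀ l, lineRestr l F = 0 → sing l → ∀ j, lineRestr l (pderiv j F) = 0 := by
      intro l hl ⟨h1, h2⟩ j
      have h := derivative_lineRestr l F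
      rw [hl, h1, h2] at h
      fin_cases j
      · simpa using h.symm
      · exact h1
      · exact h2
    have hreg : ∀ (u : K × K × K) (W : Finset (K × K × K)), ¬ sing u → (∀ v ∈ W, u.1 ≠ v.1) →
        (∀ v ∈ W, ∀ v' ∈ W, v ≠ v' → lineForm v v' ≠ 0) → (∀ v ∈ W, lineRestr v F = 0 ∧ sing v) →
        #{v ∈ W | lineForm u v = 0} ≤ k := by
      intro u W hu hs hW hWF
      rcases not_and_or.1 hu with hu | hu
      · exact card_crossings_le_of_restr_ne_zero hs hW (hdeg 1) hu fun v hv => (hWF v hv).2.1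
      · exact card_crossings_le_of_restr_ne_zero hs hW (hdeg 2) hu fun v hv => (hWF v hv).2.2
    set U0 := U.filter sing
    set U1 := U.filter (¬ sing ·)
    set V0 := V.filter sing
    set V1 := V.filter (¬ sing ·)
    have hU0 : U0 ⊆ U := filter_subset _ _
    have hU1 : U1 ⊆ U := filter_subset _ _
    have hV0 : V0 ⊆ V := filter_subset _ _
    have hV1 : V1 ⊆ V := filter_subset _ _
    have hcU : #U0 + #U1 = #U := card_filter_add_card_filter_not _
    have hcV : #V0 + #V1 = #V := card_filter_add_card_filter_not _
    have hsplit : ∀ u, #{v ∈ V | lineForm u v = 0} =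
        #{v ∈ V0 | lineForm u v = 0} + #{v ∈ V1 | lineForm u v = 0} := by
      intro u
      rw [← card_filter_add_card_filter_not (s := {v ∈ V | lineForm u v = 0}) sing,
        filter_comm, filter_comm (fun v => lineForm u v = 0)]
    have h00 := ih (by omega) (hUV.mono hU0 hV0) hi (hdeg i)
      (fun u hu => hsing u (hU u (hU0 hu)) (mem_filter.1 hu).2 i)
      (fun v hv => hsing v (hV v (hV0 hv)) (mem_filter.1 hv).2 i)
    have h11 := crossings_le_of_regular p (hUV.mono hU1 hV1) hF (by omega)
      (fun u hu => hU u (hU1 hu)) (fun v hv => hV v (hV1 hv)) fun u hu => (mem_filter.1 hu).2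
    have h10 : ∑ u ∈ U1, #{v ∈ V0 | lineForm u v = 0} ≤ #U1 * k := by
      refine sum_le_card_nsmul _ _ _ fun u hu => ?_
      exact hreg u V0 (mem_filter.1 hu).2 (fun v hv => hUV.slope_ne u (hU1 hu) v (hV0 hv))
        (fun v hv w hw => hUV.skew_right v (hV0 hv) w (hV0 hw))
        fun v hv => ⟨hV v (hV0 hv), (mem_filter.1 hv).2⟩
    have h01 : ∑ u ∈ U0, #{v ∈ V1 | lineForm u v = 0} ≤ #V1 * k := by
      have hswap := sum_card_bipartiteAbove_eq_sum_card_bipartiteBelow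
        (fun u v : K × K × K => lineForm u v = 0) (s := U0) (t := V1)
      simp only [bipartiteAbove, bipartiteBelow] at hswap
      rw [hswap]
      refine sum_le_card_nsmul _ _ _ fun v hv => ?_
      have hv' := hreg v U0 (mem_filter.1 hv).2
        (fun u hu => (hUV.slope_ne u (hU0 hu) v (hV1 hv)).symm)
        (fun u hu w hw => hUV.skew_left u (hU0 hu) w (hU0 hw))
        fun u hu => ⟨hU u (hU0 hu), (mem_filter.1 hu).2⟩
      simpa [lineForm_swap v] using hv'
    rw [← sum_filter_add_sum_filter_not U sing]
    simp only [hsplit, sum_add_distrib]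
    rw [← hcU, ← hcV]
    have e1 : (6 * k + κ) * (#U0 + #V0) ≤ (6 * (k + 1) + κ) * (#U0 + #V0) := by gcongr; omega
    nlinarith

end Counting

/-- There is a surface of degree about `√(3N)` containing `N` given lines. -/
lemma exists_surface (L : Finset (K × K × K)) {r : ℕ} (hr : 3 * #L < r ^ 2) :
    ∃ F : MvPolynomial (Fin 3) K, F ≠ 0 ∧ F.totalDegree ≤ 3 * r ∧ ∀ l ∈ L, lineRestr l F = 0 := by
  classical
  have hr0 : 0 < r := Nat.pos_of_ne_zero fun h => by simp [h] at hr
  let e : (Fin 3 → Fin r) → (Fin 3 →₀ ℕ) := fun m =>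
    Finsupp.equivFunOnFinite.symm fun i => (m i : ℕ)
  have he : Function.Injective e := by
    intro m m' h
    ext i
    exact DFunLike.congr_fun h i
  let Φ : ((Fin 3 → Fin r) → K) →ₗ[K] MvPolynomial (Fin 3) K :=
    Fintype.linearCombination K fun m => MvPolynomial.monomial (e m) 1
  have hΦ : ∀ c, Φ c = ∑ m, MvPolynomial.monomial (e m) (c m) := by
    intro c
    simp [Φ, Fintype.linearCombination_apply, MvPolynomial.smul_monomial]
  have hdeg : ∀ c, (Φ c).totalDegree ≤ 3 * (r - 1) := by
    intro c
    rw [hΦ]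
    refine MvPolynomial.totalDegree_finsetSum_le fun m _ => ?_
    refine (MvPolynomial.totalDegree_monomial_le _ _).trans ?_
    rw [Finsupp.sum_fintype _ _ (fun _ => rfl)]
    refine (sum_le_card_nsmul univ _ (r - 1) fun i _ => ?_).trans (by simp)
    exact Nat.le_sub_one_of_lt (m i).2
  let φ : ((Fin 3 → Fin r) → K) →ₗ[K] (L × Fin (3 * r) → K) :=
    LinearMap.pi fun x => Polynomial.lcoeff K x.2 ∘ₗ (lineRestr x.1.1).toLinearMap ∘ₗ Φ
  have hker : LinearMap.ker φ ≠ ⊥ := by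
    refine LinearMap.ker_ne_bot_of_finrank_lt ?_
    rw [Module.finrank_fintype_fun_eq_card, Module.finrank_fintype_fun_eq_card]
    simp only [Fintype.card_prod, Fintype.card_coe, Fintype.card_fin, Fintype.card_fun]
    nlinarith
  obtain ⟨c, hc, hc0⟩ := Submodule.exists_mem_ne_zero_of_ne_bot hker
  refine ⟨Φ c, fun h0 => hc0 ?_, (hdeg c).trans (by omega), fun l hl => ?_⟩
  · ext m
    have h := congrArg (MvPolynomial.coeff (e m)) h0
    rw [hΦ, MvPolynomial.coeff_sum] at h
    simpa [MvPolynomial.coeff_monomial, he.eq_iff] using h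
  · ext j
    by_cases hj : j < 3 * r
    · exact congrFun (LinearMap.mem_ker.1 hc) (⟨l, hl⟩, ⟨j, hj⟩)
    · rw [Polynomial.coeff_zero]
      refine Polynomial.coeff_eq_zero_of_natDegree_lt ?_
      have := natDegree_lineRestr_le l (hdeg c)
      omega

/-- An incidence bound for two families of `N` lines each. -/
lemma crossings_le [DecidableEq K] (p : ℕ) [CharP K p] {U V : Finset (K × K × K)} {κ N r : ℕ}
    (hUV : IsLineConfig U V κ) (hU : #U ≤ N) (hV : #V ≤ N) (hr : 6 * N < r ^ 2)
    (hrp : 6 * r + 1 < p) :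
    ∑ u ∈ U, #{v ∈ V | lineForm u v = 0} ≤ (18 * r + κ) * (2 * N) := by
  classical
  obtain ⟨F, hF0, hF, hL⟩ := exists_surface (U ∪ V) (r := r) (by
    have := card_union_le U V
    omega)
  refine (crossings_le_of_surface p (k := 3 * r) (by omega) hUV hF0 hF
    (fun u hu => hL u (mem_union_left _ hu)) (fun v hv => hL v (mem_union_right _ hv))).trans ?_
  exact Nat.mul_le_mul (by omega) (by omega)

end Lines

section Encoding

variable {k K : Type*} [Field k] [Field K] [Algebra k K] {T : K}

local notation "ι" => algebraMap k K

lemma ne_zero_of_transcendental (hT : Transcendental k T) : T ≠ 0 := by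
  rintro rfl
  exact hT isAlgebraic_zero

lemma eq_zero_of_transcendental (hT : Transcendental k T) {x₀ x₁ x₂ x₃ x₄ x₅ : k}
    (h : ι x₀ + ι x₁ * T + ι x₂ * T ^ 2 + ι x₃ * T ^ 3 + ι x₄ * T ^ 4 + ι x₅ * T ^ 5 = 0) :
    x₀ = 0 ∧ x₁ = 0 ∧ x₂ = 0 ∧ x₃ = 0 ∧ x₄ = 0 ∧ x₅ = 0 := by
  have hq := transcendental_iff.1 hT
    (Polynomial.C x₀ + Polynomial.C x₁ * Polynomial.X + Polynomial.C x₂ * Polynomial.X ^ 2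
      + Polynomial.C x₃ * Polynomial.X ^ 3 + Polynomial.C x₄ * Polynomial.X ^ 4
      + Polynomial.C x₅ * Polynomial.X ^ 5) (by simpa using h)
  have hc := fun n => congrArg (fun q => Polynomial.coeff q n) hq
  simp only [Polynomial.coeff_add, Polynomial.coeff_C_mul, Polynomial.coeff_X_pow,
    Polynomial.coeff_X, Polynomial.coeff_C, Polynomial.coeff_zero] at hc
  refine ⟨?_, ?_, ?_, ?_, ?_, ?_⟩
  · simpa using hc 0
  · simpa using hc 1
  · simpa using hc 2
  · simpa using hc 3
  · simpa using hc 4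
  · simpa using hc 5

/-- The line encoding the data `(b, d, β)` on one side of the equation
`(b + d')² + β' = (b' + d)² + β`. -/
noncomputable def leftLine (T : K) (x : k × k × k) : K × K × K :=
  (ι x.1 * T ^ 3, ι x.2.1, -(ι x.1 + ι x.2.1 * T + ι (x.2.1 ^ 2 + x.2.2 - x.1 ^ 2) * T ^ 2))

/-- The line encoding the data `(d, b, β)` on the other side of that equation. -/
noncomputable def rightLine (T : K) (x : k × k × k) : K × K × K :=
  (2 * ι x.2.1 * T ^ 2 - T, (2 * ι x.1 * T ^ 2 + 1) / T ^ 3,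
    -(ι (x.1 ^ 2 + x.2.2 - x.2.1 ^ 2) * T ^ 2))

lemma lineForm_leftLine_rightLine (hT : T ≠ 0) (x y : k × k × k) :
    lineForm (leftLine T x) (rightLine T y) =
      T ^ 2 * ι ((x.1 + y.1) ^ 2 + y.2.2 - ((y.2.1 + x.2.1) ^ 2 + x.2.2)) := by
  simp only [lineForm, leftLine, rightLine, map_add, map_sub, map_pow]
  field_simp
  ring

lemma eq_of_lineForm_leftLine (hT : Transcendental k T) {x y : k × k × k}
    (h : lineForm (leftLine T x) (leftLine T y) = 0) : x = y := by
  simp only [lineForm, leftLine] at h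
  obtain ⟨h0, h1, h2, -⟩ := eq_zero_of_transcendental hT (x₀ := x.1 - y.1)
    (x₁ := x.2.1 - y.2.1)
    (x₂ := (x.2.1 ^ 2 + x.2.2 - x.1 ^ 2) - (y.2.1 ^ 2 + y.2.2 - y.1 ^ 2))
    (x₃ := y.1 * x.2.1 - x.1 * y.2.1) (x₄ := 0) (x₅ := 0) (by
      simp only [map_sub, map_add, map_mul, map_pow, map_zero] at h ⊢
      linear_combination -h)
  rw [sub_eq_zero] at h0 h1
  rw [h0, h1] at h2
  refine Prod.ext h0 (Prod.ext h1 ?_)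
  linear_combination h2

lemma eq_of_lineForm_rightLine (h2 : (2 : k) ≠ 0) (hT : Transcendental k T) {x y : k × k × k}
    (h : lineForm (rightLine T x) (rightLine T y) = 0) : x = y := by
  have hT0 : T ≠ 0 := ne_zero_of_transcendental hT
  simp only [lineForm, rightLine] at h
  obtain ⟨-, -, h0, h1, -, h3⟩ := eq_zero_of_transcendental hT (x₀ := 0) (x₁ := 0)
    (x₂ := 2 * (x.2.1 - y.2.1)) (x₃ := 2 * (x.1 - y.1))
    (x₄ := 4 * (x.2.1 * y.1 - y.2.1 * x.1))
    (x₅ := -((x.1 ^ 2 + x.2.2 - x.2.1 ^ 2) - (y.1 ^ 2 + y.2.2 - y.2.1 ^ 2))) (by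
      simp only [map_sub, map_add, map_mul, map_pow, map_zero, map_neg, map_ofNat] at h ⊢
      field_simp at h
      linear_combination T * h)
  have h0' := sub_eq_zero.1 ((mul_eq_zero.1 h0).resolve_left h2)
  have h1' := sub_eq_zero.1 ((mul_eq_zero.1 h1).resolve_left h2)
  rw [h0', h1'] at h3
  refine Prod.ext h1' (Prod.ext h0' ?_)
  linear_combination -h3

lemma leftLine_injective (hT : Transcendental k T) : Function.Injective (leftLine (k := k) T) :=
  fun x y h => eq_of_lineForm_leftLine hT (by rw [h]; simp [lineForm])

lemma rightLine_injective (h2 : (2 : k) ≠ 0) (hT : Transcendental k T) :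
    Function.Injective (rightLine (k := k) T) :=
  fun x y h => eq_of_lineForm_rightLine h2 hT (by rw [h]; simp [lineForm])

lemma minor_eq_zero_of_mem_span {x y : Fin 4 → K} {l m n : K × K × K}
    (hl : lineVec l ∈ Submodule.span K {x, y}) (hm : lineVec m ∈ Submodule.span K {x, y})
    (hn : lineVec n ∈ Submodule.span K {x, y}) :
    (m.1 - l.1) * (n.2.1 - l.2.1) = (m.2.1 - l.2.1) * (n.1 - l.1) := by
  obtain ⟨a, b, h⟩ := Submodule.mem_span_pair.1 hl
  obtain ⟨a', b', h'⟩ := Submodule.mem_span_pair.1 hm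
  obtain ⟨a'', b'', h''⟩ := Submodule.mem_span_pair.1 hn
  have e : ∀ {q : K × K × K} {s t : K}, s • x + t • y = lineVec q →
      s * x 0 + t * y 0 = 1 ∧ q.1 = s * x 1 + t * y 1 ∧ q.2.1 = s * x 2 + t * y 2 := by
    intro q s t hq
    have h0 := congrFun hq 0
    have h1 := congrFun hq 1
    have h2 := congrFun hq 2
    simp only [Pi.add_apply, Pi.smul_apply, smul_eq_mul, lineVec, Matrix.cons_val_zero,
      Matrix.cons_val_one, Matrix.cons_val] at h0 h1 h2
    exact ⟨h0, h1.symm, h2.symm⟩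
  obtain ⟨h0, h1, h2⟩ := e h
  obtain ⟨h0', h1', h2'⟩ := e h'
  obtain ⟨h0'', h1'', h2''⟩ := e h''
  rw [h1, h2, h1', h2', h1'', h2'']
  linear_combination
    -((a' * x 1 + b' * y 1) * (a'' * x 2 + b'' * y 2)
      - (a' * x 2 + b' * y 2) * (a'' * x 1 + b'' * y 1)) * h0
    + ((a * x 1 + b * y 1) * (a'' * x 2 + b'' * y 2)
      - (a * x 2 + b * y 2) * (a'' * x 1 + b'' * y 1)) * h0'
    - ((a * x 1 + b * y 1) * (a' * x 2 + b' * y 2)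
      - (a * x 2 + b * y 2) * (a' * x 1 + b' * y 1)) * h0''

lemma det_eq_zero_of_rightLine_mem_span (h2 : (2 : k) ≠ 0) (hT : Transcendental k T)
    {x y : Fin 4 → K} {l m n : k × k × k}
    (hl : lineVec (rightLine T l) ∈ Submodule.span K {x, y})
    (hm : lineVec (rightLine T m) ∈ Submodule.span K {x, y})
    (hn : lineVec (rightLine T n) ∈ Submodule.span K {x, y}) :
    (m.2.1 - l.2.1) * (n.1 - l.1) = (m.1 - l.1) * (n.2.1 - l.2.1) := by
  have hT0 : T ≠ 0 := ne_zero_of_transcendental hT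
  have h := minor_eq_zero_of_mem_span hl hm hn
  have h2' : (2 : K) ≠ 0 := by
    rw [← map_ofNat (algebraMap k K) 2]
    exact (map_ne_zero _).2 h2
  refine (algebraMap k K).injective ?_
  simp only [rightLine] at h
  simp only [map_mul, map_sub]
  refine mul_left_cancel₀ (mul_ne_zero (mul_ne_zero h2' h2') (pow_ne_zero 4 hT0)) ?_
  field_simp at h
  linear_combination T * h

lemma isLineConfig_encoding [DecidableEq K] (h2 : (2 : k) ≠ 0) (hT : Transcendental k T)
    (X Y B : Finset k) (hXY : #X ≤ #Y) :
    IsLineConfig ((X ×ˢ Y ×ˢ B).image (leftLine T)) ((Y ×ˢ X ×ˢ B).image (rightLine T)) #Y where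
  skew_left := by
    simp only [mem_image]
    rintro _ ⟨q, -, rfl⟩ _ ⟨q', -, rfl⟩ hne h
    exact hne (by rw [eq_of_lineForm_leftLine hT h])
  skew_right := by
    simp only [mem_image]
    rintro _ ⟨q, -, rfl⟩ _ ⟨q', -, rfl⟩ hne h
    exact hne (by rw [eq_of_lineForm_rightLine h2 hT h])
  slope_ne := by
    simp only [mem_image]
    rintro _ ⟨q, -, rfl⟩ _ ⟨q', -, rfl⟩ h
    simp only [leftLine, rightLine] at h
    obtain ⟨-, h1, -⟩ := eq_zero_of_transcendental hT (x₀ := 0) (x₁ := 1) (x₂ := -2 * q'.2.1)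
      (x₃ := q.1) (x₄ := 0) (x₅ := 0) (by
        simp only [map_zero, map_one, map_mul, map_neg, map_ofNat]
        linear_combination h)
    exact one_ne_zero h1
  collinear := by
    classical
    simp only [mem_image]
    rintro _ ⟨q, -, rfl⟩ x y S hSV hS
    have hT0 : T ≠ 0 := ne_zero_of_transcendental hT
    set S' : Finset (k × k × k) := {z ∈ Y ×ˢ X ×ˢ B | rightLine T z ∈ S} with hS'
    have hSS' : #S ≤ #S' := by
      refine (card_le_card fun v hv => ?_).trans (card_image_le (f := rightLine T))
      obtain ⟨z, hz, rfl⟩ := mem_image.1 (hSV hv)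
      exact mem_image_of_mem _ (mem_filter.2 ⟨hz, hv⟩)
    refine hSS'.trans ?_
    have hmem : ∀ z ∈ S', z.1 ∈ Y ∧ z.2.1 ∈ X := by
      intro z hz
      simp only [hS', mem_filter, mem_product] at hz
      exact ⟨hz.1.1, hz.1.2.1⟩
    have hinc : ∀ z ∈ S', (q.1 + z.1) ^ 2 + z.2.2 - ((z.2.1 + q.2.1) ^ 2 + q.2.2) = 0 := by
      intro z hz
      have h := (hS _ (mem_filter.1 hz).2).1
      rw [lineForm_leftLine_rightLine hT0] at h
      exact (map_eq_zero (algebraMap k K)).1 ((mul_eq_zero.1 h).resolve_left (pow_ne_zero 2 hT0))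
    have hdet : ∀ l ∈ S', ∀ m ∈ S', ∀ n ∈ S',
        (m.2.1 - l.2.1) * (n.1 - l.1) = (m.1 - l.1) * (n.2.1 - l.2.1) := fun l hl m hm n hn =>
      det_eq_zero_of_rightLine_mem_span h2 hT (hS _ (mem_filter.1 hl).2).2
        (hS _ (mem_filter.1 hm).2).2 (hS _ (mem_filter.1 hn).2).2
    have hext : ∀ z ∈ S', ∀ w ∈ S', z.1 = w.1 → z.2.1 = w.2.1 → z = w := by
      intro z hz w hw h1 h3
      refine Prod.ext h1 (Prod.ext h3 ?_)
      have hz' := hinc z hz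
      have hw' := hinc w hw
      rw [h1, h3] at hz'
      linear_combination hz' - hw'
    by_cases hconst : ∀ z ∈ S', ∀ w ∈ S', z.1 = w.1
    · refine (card_le_card_of_injOn (fun z => z.2.1) (fun z hz => (hmem z hz).2) ?_).trans hXY
      exact fun z hz w hw h => hext z hz w hw (hconst z hz w hw) h
    · push Not at hconst
      obtain ⟨z₁, hz₁, z₂, hz₂, hne⟩ := hconst
      refine card_le_card_of_injOn (fun z => z.1) (fun z hz => (hmem z hz).1) ?_
      intro z hz w hw h
      simp only at h
      refine hext z hz w hw h ?_
      have e1 := hdet z hz w hw z₁ hz₁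
      have e2 := hdet z hz w hw z₂ hz₂
      rw [← h, sub_self, zero_mul] at e1 e2
      have : (w.2.1 - z.2.1) * (z₁.1 - z₂.1) = 0 := by linear_combination e1 - e2
      exact (sub_eq_zero.1 ((mul_eq_zero.1 this).resolve_right (sub_ne_zero.2 hne))).symm

end Encoding

lemma card_filter_product_eq_sum {α β γ : Type*} [DecidableEq γ] [Fintype γ] (S : Finset α)
    (S' : Finset β) (f : α → γ) (g : β → γ) :
    #{z ∈ S ×ˢ S' | f z.1 = g z.2} = ∑ x, #{a ∈ S | f a = x} * #{b ∈ S' | g b = x} := by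
  rw [card_eq_sum_card_fiberwise (f := fun z => f z.1) (t := univ) (fun _ _ => mem_univ _)]
  refine sum_congr rfl fun x _ => ?_
  rw [← card_product, ← filter_product, filter_filter]
  refine congrArg card (filter_congr fun z _ => ?_)
  constructor
  · rintro ⟨h, h'⟩
    exact ⟨h', h ▸ h'⟩
  · rintro ⟨h, h'⟩
    exact ⟨h.trans h'.symm, h⟩

section Energy

variable {p : ℕ} [Fact p.Prime]

/-- The additive energy of the multiset `{a² : a ∈ A}` and the set `B`. -/
def sqEnergy (A B : Finset (ZMod p)) : ℕ :=
  ∑ x, #{z ∈ A ×ˢ B | z.1 ^ 2 + z.2 = x} ^ 2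

lemma card_sq_mul_sqEnergy_le (h2 : (2 : ZMod p) ≠ 0) {A B : Finset (ZMod p)}
    (hA : #A ≤ #(A - A)) {r : ℕ} (hr : 6 * (#A * #(A - A) * #B) < r ^ 2) (hrp : 6 * r + 1 < p) :
    #A ^ 2 * sqEnergy A B ≤ (18 * r + #(A - A)) * (2 * (#A * #(A - A) * #B)) := by
  classical
  have hT : Transcendental (ZMod p) (RatFunc.X : RatFunc (ZMod p)) := RatFunc.transcendental_X
  set T : RatFunc (ZMod p) := RatFunc.X
  have hcard : ∀ S : Finset (ZMod p × ZMod p × ZMod p), #S = #A * #(A - A) * #B →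
      ∀ f : ZMod p × ZMod p × ZMod p → RatFunc (ZMod p) × RatFunc (ZMod p) × RatFunc (ZMod p),
      #(S.image f) ≤ #A * #(A - A) * #B := fun S hS f => card_image_le.trans hS.le
  have hinc := crossings_le p (isLineConfig_encoding h2 hT A (A - A) B hA)
    (hcard _ (by simp only [card_product]; ring) _) (hcard _ (by simp only [card_product]; ring) _)
    hr hrp
  refine le_trans ?_ hinc
  have hE : sqEnergy A B =
      #{z ∈ (A ×ˢ B) ×ˢ (A ×ˢ B) | z.1.1 ^ 2 + z.1.2 = z.2.1 ^ 2 + z.2.2} := by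
    rw [card_filter_product_eq_sum (A ×ˢ B) (A ×ˢ B) (fun z => z.1 ^ 2 + z.2)
      (fun z => z.1 ^ 2 + z.2)]
    simp only [sqEnergy, sq]
  rw [hE, sq, ← card_product, ← card_product]
  simp only [card_filter]
  rw [← sum_product', ← card_filter]
  refine card_le_card_of_injOn (fun w => (leftLine T (w.1.1, w.2.2.1 - w.1.2, w.2.2.2),
    rightLine T (w.2.1.1 - w.1.1, w.1.2, w.2.1.2))) ?_ ?_
  · rintro ⟨⟨b, b'⟩, ⟨a, β⟩, a', β'⟩ hw
    simp only [coe_filter, coe_product, mem_product, Set.mem_prod, mem_coe,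
      Set.mem_ofPred_eq] at hw ⊢
    obtain ⟨⟨hb, hb'⟩, ⟨⟨ha, hβ⟩, ha', hβ'⟩, heq⟩ := hw
    refine ⟨⟨mem_image_of_mem _ ?_, mem_image_of_mem _ ?_⟩, ?_⟩
    · simp only [mem_product]
      exact ⟨hb, sub_mem_sub ha' hb', hβ'⟩
    · simp only [mem_product]
      exact ⟨sub_mem_sub ha hb, hb', hβ⟩
    · rw [lineForm_leftLine_rightLine (ne_zero_of_transcendental hT)]
      simp only [add_sub_cancel, heq, sub_self, map_zero, mul_zero]
  · rintro ⟨⟨b, b'⟩, ⟨a, β⟩, a', β'⟩ - ⟨⟨c, c'⟩, ⟨e, γ⟩, e', γ'⟩ - h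
    have h1 := leftLine_injective hT (congrArg Prod.fst h)
    have h3 := rightLine_injective h2 hT (congrArg Prod.snd h)
    simp only [Prod.mk.injEq] at h1 h3 ⊢
    obtain ⟨rfl, h1, rfl⟩ := h1
    obtain ⟨h3, rfl, rfl⟩ := h3
    exact ⟨⟨rfl, rfl⟩, ⟨sub_left_injective h3, rfl⟩, sub_left_injective h1, rfl⟩

lemma sqEnergy_le {A B : Finset (ZMod p)} (hA : A.Nonempty) {Q : ℕ} (hBQ : #A * #(A - A) * #B ≤ Q)
    (hd : #(A - A) ^ 2 ≤ 2 * Q) (hQ : 0 < Q) (hQp : 1000 * Q ≤ p ^ 2) :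
    (#A : ℝ) * sqEnergy A B ≤ 200 * √Q * #(A - A) * #B := by
  have h2 : (2 : ZMod p) ≠ 0 := by
    intro h
    have hdvd := (ZMod.natCast_eq_zero_iff 2 p).1 (by exact_mod_cast h)
    have := Nat.le_of_dvd two_pos hdvd
    nlinarith
  have hAd : #A ≤ #(A - A) := card_le_card_sub_right hA
  have hQ1 : 1 ≤ √(Q : ℝ) := Real.one_le_sqrt.2 (by exact_mod_cast hQ)
  set q := √(Q : ℝ)
  have hqq : q ^ 2 = Q := Real.sq_sqrt (by positivity)
  have hq6 : √(6 * Q : ℝ) ≤ 5 / 2 * q := by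
    rw [Real.sqrt_le_left (by positivity)]
    nlinarith
  have hs : (Nat.sqrt (6 * Q) : ℝ) ≤ 5 / 2 * q := by
    refine le_trans ?_ hq6
    have := Real.nat_sqrt_le_real_sqrt (a := 6 * Q)
    push_cast at this
    exact this
  have hqp : 31 * q ≤ p := by
    have hQp' : (1000 : ℝ) * Q ≤ p ^ 2 := by exact_mod_cast hQp
    refine le_of_sq_le_sq ?_ (by positivity)
    nlinarith
  have hmain := card_sq_mul_sqEnergy_le h2 (B := B) hAd (r := Nat.sqrt (6 * Q) + 1)
    (lt_of_le_of_lt (by gcongr) (Nat.lt_succ_sqrt' (6 * Q))) (by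
      have : (6 * (Nat.sqrt (6 * Q) + 1) + 1 : ℝ) < p := by linarith
      exact_mod_cast this)
  have hmain' : (#A : ℝ) ^ 2 * sqEnergy A B ≤
      (18 * (Nat.sqrt (6 * Q) + 1) + #(A - A)) * (2 * (#A * #(A - A) * #B)) := by
    exact_mod_cast hmain
  have hdq : (#(A - A) : ℝ) ≤ 2 * q := by
    have hd' : (#(A - A) : ℝ) ^ 2 ≤ 2 * Q := by exact_mod_cast hd
    refine le_of_sq_le_sq ?_ (by positivity)
    nlinarith
  have hA0 : (0 : ℝ) < #A := by exact_mod_cast hA.card_pos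
  refine le_of_mul_le_mul_left ?_ hA0
  calc (#A : ℝ) * (#A * sqEnergy A B) = #A ^ 2 * sqEnergy A B := by ring
    _ ≤ (18 * (Nat.sqrt (6 * Q) + 1) + #(A - A)) * (2 * (#A * #(A - A) * #B)) := hmain'
    _ ≤ (100 * q) * (2 * (#A * #(A - A) * #B)) := by
      gcongr
      linarith
    _ = #A * (200 * q * #(A - A) * #B) := by ring

end Energy

section Popular

variable {p : ℕ} [Fact p.Prime]

lemma card_le_two_mul_card_sqSet (A : Finset (ZMod p)) : #A ≤ 2 * #(sqSet A) := by
  refine card_le_mul_card_image A 2 fun y hy => ?_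
  obtain ⟨a, -, rfl⟩ := mem_image.1 hy
  refine (card_le_card (t := {a, -a}) fun x hx => ?_).trans card_le_two
  simpa [sq_eq_sq_iff_eq_or_eq_neg] using (mem_filter.1 hx).2

lemma rep_le_card_filter (A : Finset (ZMod p)) (x : ZMod p) :
    rep A x ≤ #{z ∈ A ×ˢ A | z.1 ^ 2 - z.2 ^ 2 = x} := by
  refine (card_le_card fun q hq => ?_).trans (card_image_le (f := fun z => (z.1 ^ 2, z.2 ^ 2)))
  simp only [mem_filter, mem_product, sqSet, mem_image] at hq
  obtain ⟨⟨⟨a, ha, ha'⟩, b, hb, hb'⟩, hx⟩ := hq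
  refine mem_image.2 ⟨(a, b), ?_, Prod.ext ha' hb'⟩
  rw [mem_filter, mem_product]
  exact ⟨⟨ha, hb⟩, by rw [ha', hb', hx]⟩

lemma card_mul_le_sum_mul (A W : Finset (ZMod p)) {s : ℝ}
    (hW : ∀ w ∈ W, s ≤ #(Pw A w)) :
    #W * (s * ((#A : ℝ) ^ 2 / (2 * #(sqDiff A)))) ≤
      ∑ x, (#{z ∈ A ×ˢ sqDiff A | z.1 ^ 2 + z.2 = x} : ℝ) *
        #{z ∈ A ×ˢ (-W) | z.1 ^ 2 + z.2 = x} := by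
  have hsum : ∑ x, #{z ∈ A ×ˢ sqDiff A | z.1 ^ 2 + z.2 = x} * #{z ∈ A ×ˢ (-W) | z.1 ^ 2 + z.2 = x} =
      #{z ∈ (A ×ˢ sqDiff A) ×ˢ (A ×ˢ (-W)) | z.1.1 ^ 2 + z.1.2 = z.2.1 ^ 2 + z.2.2} :=
    (card_filter_product_eq_sum (A ×ˢ sqDiff A) (A ×ˢ (-W)) (fun z => z.1 ^ 2 + z.2)
      (fun z => z.1 ^ 2 + z.2)).symm
  have hinj : ∑ w ∈ W, ∑ u ∈ Pw A w, #{z ∈ A ×ˢ A | z.1 ^ 2 - z.2 ^ 2 = u + w} ≤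
      #{z ∈ (A ×ˢ sqDiff A) ×ˢ (A ×ˢ (-W)) | z.1.1 ^ 2 + z.1.2 = z.2.1 ^ 2 + z.2.2} := by
    simp only [← card_sigma]
    refine card_le_card_of_injOn (fun y => ((y.2.2.2, y.2.1), (y.2.2.1, -y.1))) ?_ ?_
    · rintro ⟨w, u, a, b⟩ hy
      simp only [coe_sigma, Set.mem_sigma_iff, mem_coe, mem_filter, mem_product] at hy ⊢
      obtain ⟨hw, hu, ⟨ha, hb⟩, heq⟩ := hy
      refine ⟨⟨⟨hb, (mem_inter.1 hu).1⟩, ha, neg_mem_neg hw⟩, ?_⟩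
      linear_combination -heq
    · rintro ⟨w, u, a, b⟩ - ⟨w', u', a', b'⟩ - h
      simp only [Prod.mk.injEq, neg_inj] at h
      obtain ⟨⟨rfl, rfl⟩, rfl, rfl⟩ := h
      rfl
  have hle : (#W * (s * ((#A : ℝ) ^ 2 / (2 * #(sqDiff A))))) ≤
      ∑ w ∈ W, ∑ u ∈ Pw A w, (#{z ∈ A ×ˢ A | z.1 ^ 2 - z.2 ^ 2 = u + w} : ℝ) := by
    rw [← nsmul_eq_mul]
    refine card_nsmul_le_sum _ _ _ fun w hw => ?_
    refine (mul_le_mul_of_nonneg_right (hW w hw) (by positivity)).trans ?_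
    rw [← nsmul_eq_mul]
    refine card_nsmul_le_sum _ _ _ fun u hu => ?_
    obtain ⟨x, hx, rfl⟩ := mem_image.1 (mem_inter.1 hu).2
    rw [sub_add_cancel]
    exact (mem_filter.1 hx).2.trans (by exact_mod_cast rep_le_card_filter A x)
  refine hle.trans ?_
  rw [← hsum] at hinj
  exact_mod_cast hinj

/-- The arithmetic turning the Cauchy–Schwarz bound `h` and the two energy bounds into the bound on
the number `w` of differences `w` with `|P_w| ≥ s`. -/
lemma le_of_sq_le_mul_of_le {n d D w s q e₁ e₂ : ℝ} (hn : 0 < n) (hD : 0 < D) (hd : 0 ≤ d)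
    (hw : 0 ≤ w) (hs : 0 < s) (he₂ : 0 ≤ e₂) (hq0 : 0 ≤ q)
    (h₁ : n * e₁ ≤ 200 * q * d * D) (h₂ : n * e₂ ≤ 200 * q * d * w) (hq : q ^ 2 = D * d * n)
    (h : (w * (s * (n ^ 2 / (2 * D)))) ^ 2 ≤ e₁ * e₂) :
    w ≤ 160000 * (D / n) ^ 4 * (d / n) ^ 3 * n ^ 2 / s ^ 2 := by
  rcases hw.eq_or_lt with rfl | hw
  · positivity
  have key : (n * (w * (s * (n ^ 2 / (2 * D))))) ^ 2 ≤ 40000 * (D * d * n) * d ^ 2 * D * w := by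
    calc _ = n ^ 2 * (w * (s * (n ^ 2 / (2 * D)))) ^ 2 := by ring
      _ ≤ n ^ 2 * (e₁ * e₂) := by gcongr
      _ = n * e₁ * (n * e₂) := by ring
      _ ≤ 200 * q * d * D * (200 * q * d * w) := by gcongr
      _ = 40000 * q ^ 2 * d ^ 2 * D * w := by ring
      _ = _ := by rw [hq]
  have hl : (n * (w * (s * (n ^ 2 / (2 * D))))) ^ 2 =
      n * w / (4 * D ^ 2) * (w * s ^ 2 * n ^ 5) := by field_simp; ring
  have hr : 40000 * (D * d * n) * d ^ 2 * D * w =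
      n * w / (4 * D ^ 2) * (160000 * D ^ 4 * d ^ 3) := by field_simp; ring
  rw [hl, hr] at key
  have := le_of_mul_le_mul_left key (by positivity)
  have hrhs : 160000 * (D / n) ^ 4 * (d / n) ^ 3 * n ^ 2 / s ^ 2 =
      160000 * D ^ 4 * d ^ 3 / (s ^ 2 * n ^ 5) := by field_simp
  rw [hrhs, le_div_iff₀ (by positivity), ← mul_assoc]
  exact this

end Popular

/-- There exist absolute constants `C, c > 0` such that for every prime `p` and every
nonempty `A ⊆ 𝔽_p` with `|A²-A²|·|A-A|·|A| ≤ c·p²`, for every real `s > 0`,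
`#{w ∈ A²-A² : |P_w| ≥ s} ≤ C·K⁴·M³·|A|²/s²` with `M = |A-A|/|A|`, `K = |A²-A²|/|A|`. -/
theorem Pw_large_count :
    ∃ C c : ℝ, 0 < C ∧ 0 < c ∧
      ∀ (p : ℕ), p.Prime →
        ∀ A : Finset (ZMod p), A.Nonempty →
          (((sqDiff A).card : ℝ) * ((A - A).card : ℝ) * (A.card : ℝ) ≤ c * (p : ℝ) ^ 2) →
          ∀ s : ℝ, 0 < s →
            (Set.ncard {w : ZMod p | w ∈ sqDiff A ∧ s ≤ ((Pw A w).card : ℝ)} : ℝ) ≤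
              C * (((sqDiff A).card : ℝ) / (A.card : ℝ)) ^ 4
                * (((A - A).card : ℝ) / (A.card : ℝ)) ^ 3
                * (A.card : ℝ) ^ 2 / s ^ 2 := by
  classical
  refine ⟨160000, 1 / 1000, by norm_num, by norm_num, fun p hp A hA hc s hs => ?_⟩
  have : Fact p.Prime := ⟨hp⟩
  set W := (sqDiff A).filter fun w => s ≤ ((Pw A w).card : ℝ) with hW
  have hWs : {w : ZMod p | w ∈ sqDiff A ∧ s ≤ ((Pw A w).card : ℝ)} = W := by
    ext w
    simp [hW]
  rw [hWs, Set.ncard_coe_finset]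
  have hS : (sqSet A).Nonempty := hA.image _
  have hD : (sqDiff A).Nonempty := hS.sub hS
  have hnD : #A ≤ 2 * #(sqDiff A) := (card_le_two_mul_card_sqSet A).trans
    (Nat.mul_le_mul_left 2 (card_le_card_sub_right hS))
  have hdn : #(A - A) ≤ #A * #A := card_sub_le
  have hQp : 1000 * (#(sqDiff A) * #(A - A) * #A) ≤ p ^ 2 := by
    have : (1000 * (#(sqDiff A) * #(A - A) * #A) : ℝ) ≤ p ^ 2 := by linarith
    exact_mod_cast this
  have hd2 : #(A - A) ^ 2 ≤ 2 * (#(sqDiff A) * #(A - A) * #A) := by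
    calc #(A - A) ^ 2 = #(A - A) * #(A - A) := sq _
      _ ≤ #(A - A) * (#A * (2 * #(sqDiff A))) := by gcongr; exact hdn.trans (by gcongr)
      _ = 2 * (#(sqDiff A) * #(A - A) * #A) := by ring
  have hn0 := hA.card_pos
  have hd0 := (hA.sub hA).card_pos
  have hD0 := hD.card_pos
  have hQ0 : 0 < #(sqDiff A) * #(A - A) * #A := by positivity
  have hWD : #(-W) ≤ #(sqDiff A) := by
    rw [card_neg]
    exact card_filter_le _ _
  have hE1 := sqEnergy_le hA (B := sqDiff A) (Q := #(sqDiff A) * #(A - A) * #A)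
    (by apply le_of_eq; ring) hd2 hQ0 hQp
  have hE2 := sqEnergy_le hA (B := -W) (Q := #(sqDiff A) * #(A - A) * #A) (by
    calc #A * #(A - A) * #(-W) ≤ #A * #(A - A) * #(sqDiff A) := by gcongr
      _ = _ := by ring) hd2 hQ0 hQp
  have hcount := card_mul_le_sum_mul A W fun w hw => (mem_filter.1 hw).2
  have hCS := sum_mul_sq_le_sq_mul_sq univ
    (fun x => (#{z ∈ A ×ˢ sqDiff A | z.1 ^ 2 + z.2 = x} : ℝ))
    (fun x => (#{z ∈ A ×ˢ (-W) | z.1 ^ 2 + z.2 = x} : ℝ))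
  have hsq := (pow_le_pow_left₀ (by positivity) hcount 2).trans hCS
  have hcast : ∀ B : Finset (ZMod p),
      ∑ x, (#{z ∈ A ×ˢ B | z.1 ^ 2 + z.2 = x} : ℝ) ^ 2 = sqEnergy A B := by
    intro B
    simp [sqEnergy]
  rw [hcast, hcast] at hsq
  rw [card_neg] at hE2
  have hn : (0 : ℝ) < #A := by exact_mod_cast hn0
  have hDr : (0 : ℝ) < #(sqDiff A) := by exact_mod_cast hD0
  have hqq : √((#(sqDiff A) * #(A - A) * #A : ℕ) : ℝ) ^ 2 = #(sqDiff A) * #(A - A) * #A := by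
    rw [Real.sq_sqrt (by positivity)]
    push_cast
    rfl
  set q := √((#(sqDiff A) * #(A - A) * #A : ℕ) : ℝ)
  have he₁ : (0 : ℝ) ≤ sqEnergy A (sqDiff A) := Nat.cast_nonneg _
  have he₂ : (0 : ℝ) ≤ sqEnergy A (-W) := Nat.cast_nonneg _
  have hq0 : 0 ≤ q := Real.sqrt_nonneg _
  exact le_of_sq_le_mul_of_le hn hDr (Nat.cast_nonneg _) (Nat.cast_nonneg _) hs he₂ hq0 hE1 hE2
    hqq hsq

end FpSumProd
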